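/- There is a universal constant c > 0 such that the following holds for every n ≥ 2. Let B = I_n, let 𝒱 = {e_i + e_j : 1 ≤ i < j ≤ n} (so |𝒱| = n(n−1)/2), let {a_v}_{v∈𝒱} be a uniform random point of the sphere of radius √2 in ℝ^𝒱, independent of X, and let f(x) = Re(Σ_{v∈𝒱} a_v e^{2πi⟨v,x⟩}). Then 𝔼_a[ d_TV(f(X), Z) ] ≤ c/√n. -/

import Mathlib

open MeasureTheory ProbabilityTheory Real Finset Matrix

noncomputable section

/-- total variation distance between two (Borel) measures on ℝ -/
def dTV (μ ν : MeasureTheory.Measure ℝ) : ℝ :=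
  ⨆ s : {s : Set ℝ // MeasurableSet s}, |(μ s.1).toReal - (ν s.1).toReal|

/-- uniform probability measure on the unit sphere of a Euclidean space -/
def sphereUniform (ι : Type*) [Fintype ι] :
    MeasureTheory.Measure (Metric.sphere (0 : EuclideanSpace ℝ ι) 1) :=
  ((volume : MeasureTheory.Measure (EuclideanSpace ℝ ι)).toSphere Set.univ)⁻¹ •
    (volume : MeasureTheory.Measure (EuclideanSpace ℝ ι)).toSphere

/-- the uniform probability measure on the flat torus `ℝ^n/ℤ^n`, modelled by Lebesgue
measure on the fundamental domain `[0,1)^n`. -/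
def torusMeasure (n : ℕ) : MeasureTheory.Measure (Fin n → ℝ) :=
  volume.restrict (Set.univ.pi fun _ => Set.Ico (0 : ℝ) 1)

/-- the uniform probability distribution of the coefficients: a uniform random point of
the sphere of radius `√2` in `ℝ^𝒱`. -/
def coeffMeasure {n : ℕ} (𝒱 : Finset (Fin n → ℝ)) : MeasureTheory.Measure (↥𝒱 → ℝ) :=
  MeasureTheory.Measure.map
    (fun c : Metric.sphere (0 : EuclideanSpace ℝ ↥𝒱) 1 =>
      fun v => Real.sqrt 2 * (c : EuclideanSpace ℝ ↥𝒱) v)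
    (sphereUniform ↥𝒱)

/-- `f(x) = Re ∑_{v ∈ 𝒱} a_v e^{2πi⟨Bv,x⟩}` -/
def torusFun {n : ℕ} (B : Matrix (Fin n) (Fin n) ℝ) (𝒱 : Finset (Fin n → ℝ))
    (a : ↥𝒱 → ℝ) (x : Fin n → ℝ) : ℝ :=
  (∑ v : ↥𝒱, (a v : ℂ) *
    Complex.exp (2 * π * Complex.I * ((B.mulVec v ⬝ᵥ x : ℝ) : ℂ))).re

/-- `∇_B f(x) = −Im(∑_{v∈𝒱} 2π a_v e^{2πi⟨Bv,x⟩} v)` -/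
def gradB {n : ℕ} (B : Matrix (Fin n) (Fin n) ℝ) (𝒱 : Finset (Fin n → ℝ))
    (a : ↥𝒱 → ℝ) (x : Fin n → ℝ) : Fin n → ℝ := fun k =>
  -(∑ v : ↥𝒱, 2 * π * (a v : ℂ) *
      Complex.exp (2 * π * Complex.I * ((B.mulVec v ⬝ᵥ x : ℝ) : ℂ)) *
      ((v : Fin n → ℝ) k : ℂ)).im

/-- `‖w‖_B² = ⟨Bw,w⟩` -/
def normBsq {n : ℕ} (B : Matrix (Fin n) (Fin n) ℝ) (w : Fin n → ℝ) : ℝ :=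
  B.mulVec w ⬝ᵥ w

end

section Sphere

variable {ι : Type*} [Fintype ι]

/-- The action of a linear isometry on the unit sphere. -/
noncomputable def sphereMap (L : EuclideanSpace ℝ ι ≃ₗᵢ[ℝ] EuclideanSpace ℝ ι)
    (u : Metric.sphere (0 : EuclideanSpace ℝ ι) 1) : Metric.sphere (0 : EuclideanSpace ℝ ι) 1 :=
  ⟨L u, by simp⟩

lemma continuous_sphereMap (L : EuclideanSpace ℝ ι ≃ₗᵢ[ℝ] EuclideanSpace ℝ ι) :
    Continuous (sphereMap L) :=
  (L.continuous.comp continuous_subtype_val).subtype_mk _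

lemma measurePreserving_sphereMap (L : EuclideanSpace ℝ ι ≃ₗᵢ[ℝ] EuclideanSpace ℝ ι) :
    MeasurePreserving (sphereMap L) (sphereUniform ι) (sphereUniform ι) := by
  refine MeasurePreserving.smul_measure (R := ENNReal) ⟨(continuous_sphereMap L).measurable, ?_⟩ _
  ext s hs
  rw [Measure.map_apply (continuous_sphereMap L).measurable hs, Measure.toSphere_apply' _ hs,
    Measure.toSphere_apply' _ ((continuous_sphereMap L).measurable hs)]
  symm
  congr 1
  rw [← (L.measurePreserving).measure_preimage_emb L.toMeasurableEquiv.measurableEmbedding]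
  congr 1
  ext x
  simp only [Set.mem_preimage, Set.mem_smul, Set.mem_image, Subtype.exists]
  constructor
  · rintro ⟨r, hr, _, ⟨u, hu, hus, rfl⟩, h⟩
    refine ⟨r, hr, _, ⟨L.symm u, by simpa using hu, ?_, rfl⟩, ?_⟩
    · simpa [sphereMap] using hus
    · apply L.injective
      simp only [map_smul, LinearIsometryEquiv.apply_symm_apply]
      exact h
  · rintro ⟨r, hr, _, ⟨u, hu, hus, rfl⟩, rfl⟩
    exact ⟨r, hr, _, ⟨L u, by simpa using hu, hus, rfl⟩, by simp⟩

instance isProbabilityMeasure_sphereUniform [Nonempty ι] :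
    IsProbabilityMeasure (sphereUniform ι) := by
  constructor
  rw [sphereUniform, Measure.smul_apply, smul_eq_mul, ENNReal.inv_mul_cancel]
  · simp [-Measure.toSphere_apply_univ, Measure.measure_univ_eq_zero]
  · exact measure_ne_top _ _

lemma integrable_sphereUniform [Nonempty ι]
    {F : Metric.sphere (0 : EuclideanSpace ℝ ι) 1 → ℝ} (hF : Continuous F) :
    Integrable F (sphereUniform ι) :=
  hF.integrable_of_hasCompactSupport (HasCompactSupport.of_compactSpace F)

lemma integral_sphereUniform_reflection [DecidableEq ι] (w : EuclideanSpace ℝ ι)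
    (F : (ι → ℝ) → ℝ) :
    ∫ u, F (fun k => (u : EuclideanSpace ℝ ι) k) ∂(sphereUniform ι) =
      ∫ u, F (fun k => (u : EuclideanSpace ℝ ι) k -
        2 * ((∑ l, w l * (u : EuclideanSpace ℝ ι) l) / ∑ l, w l ^ 2) * w k)
        ∂(sphereUniform ι) := by
  have e : MeasurableEmbedding (sphereMap ((ℝ ∙ w)ᗮ.reflection)) := by
    refine (Topology.IsClosedEmbedding.measurableEmbedding ?_)
    refine (continuous_sphereMap _).isClosedEmbedding ?_
    intro u v h
    simpa [sphereMap, Subtype.ext_iff] using h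
  rw [← (measurePreserving_sphereMap ((ℝ ∙ w)ᗮ.reflection)).integral_comp e]
  congr 1
  ext u
  congr 1
  ext k
  simp [sphereMap, Submodule.reflection_orthogonal_apply, Submodule.reflection_singleton_apply,
    EuclideanSpace.real_norm_sq_eq, PiLp.inner_apply, mul_comm]
  ring

end Sphere

section SphereMoments

variable {ι : Type*} [Fintype ι]

lemma integral_sphereUniform_update_neg [DecidableEq ι] (i : ι) (F : (ι → ℝ) → ℝ) :
    ∫ u, F (fun k => (u : EuclideanSpace ℝ ι) k) ∂(sphereUniform ι) =
      ∫ u, F (fun k => if k = i then -(u : EuclideanSpace ℝ ι) k else (u : EuclideanSpace ℝ ι) k)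
        ∂(sphereUniform ι) := by
  rw [integral_sphereUniform_reflection (EuclideanSpace.single i 1)]
  congr 1
  ext u
  congr 1
  ext k
  by_cases h : k = i
  · subst h
    simp
    ring
  · simp [h]

lemma integral_sphereUniform_swap [DecidableEq ι] (i j : ι) (hij : i ≠ j) (F : (ι → ℝ) → ℝ) :
    ∫ u, F (fun k => (u : EuclideanSpace ℝ ι) k) ∂(sphereUniform ι) =
      ∫ u, F (fun k => (u : EuclideanSpace ℝ ι) (Equiv.swap i j k)) ∂(sphereUniform ι) := by
  rw [integral_sphereUniform_reflection (EuclideanSpace.single i 1 - EuclideanSpace.single j 1)]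
  congr 1
  ext u
  congr 1
  ext k
  have h2 : ∑ l, ((EuclideanSpace.single i 1 - EuclideanSpace.single j 1 :
      EuclideanSpace ℝ ι) l) ^ 2 = 2 := by
    simp [sub_sq, Finset.sum_add_distrib, hij.symm]
    norm_num
  have h1 : ∑ l, (EuclideanSpace.single i 1 - EuclideanSpace.single j 1 :
      EuclideanSpace ℝ ι) l * (u : EuclideanSpace ℝ ι) l =
      (u : EuclideanSpace ℝ ι) i - (u : EuclideanSpace ℝ ι) j := by
    simp [sub_mul]
  rw [h1, h2]
  by_cases h : k = i
  · subst h
    simp [hij]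
    ring
  · by_cases hkj : k = j
    · subst hkj
      simp [h]
      ring
    · simp [h, hkj, Equiv.swap_apply_of_ne_of_ne h hkj]

/-- Invariance of the fourth moment under the reflection along `e_i + 2 e_j`. -/
lemma integral_sphereUniform_pow_four_mix (i j : ι) (hij : i ≠ j) :
    ∫ u, ((u : EuclideanSpace ℝ ι) i) ^ 4 ∂(sphereUniform ι) =
      ∫ u, ((3 * (u : EuclideanSpace ℝ ι) i - 4 * (u : EuclideanSpace ℝ ι) j) / 5) ^ 4
        ∂(sphereUniform ι) := by
  classical
  rw [integral_sphereUniform_reflection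
    (EuclideanSpace.single i 1 + EuclideanSpace.single j 2) (fun u => (u i) ^ 4)]
  congr 1
  ext u
  have h2 : ∑ l, ((EuclideanSpace.single i 1 + EuclideanSpace.single j 2 :
      EuclideanSpace ℝ ι) l) ^ 2 = 5 := by
    simp [add_sq, Finset.sum_add_distrib, hij.symm]
    norm_num
  have h1 : ∑ l, (EuclideanSpace.single i 1 + EuclideanSpace.single j 2 :
      EuclideanSpace ℝ ι) l * (u : EuclideanSpace ℝ ι) l =
      (u : EuclideanSpace ℝ ι) i + 2 * (u : EuclideanSpace ℝ ι) j := by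
    simp [add_mul, Finset.sum_add_distrib]
  rw [h1, h2]
  simp [hij]
  ring

/-- The moment `𝔼[u_i u_j u_k u_l]` of the uniform distribution on the sphere. -/
noncomputable def sphereMoment (i j k l : ι) : ℝ :=
  ∫ u, (u : EuclideanSpace ℝ ι) i * (u : EuclideanSpace ℝ ι) j * (u : EuclideanSpace ℝ ι) k *
    (u : EuclideanSpace ℝ ι) l ∂(sphereUniform ι)

lemma integrable_sphereMoment [Nonempty ι] (i j k l : ι) :
    Integrable (fun u : Metric.sphere (0 : EuclideanSpace ℝ ι) 1 =>
      (u : EuclideanSpace ℝ ι) i * (u : EuclideanSpace ℝ ι) j * (u : EuclideanSpace ℝ ι) k *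
      (u : EuclideanSpace ℝ ι) l) (sphereUniform ι) :=
  integrable_sphereUniform (by fun_prop)

lemma sphereMoment_eq_zero (i j k l : ι) (hi : i ≠ l) (hj : j ≠ l) (hk : k ≠ l) :
    sphereMoment i j k l = 0 := by
  classical
  have h := integral_sphereUniform_update_neg l (fun u => u i * u j * u k * u l)
  simp only [hi, hj, hk, if_false, if_true, mul_neg, integral_neg] at h
  unfold sphereMoment
  linarith

lemma sphereMoment_odd (i l : ι) (hi : i ≠ l) : sphereMoment i i i l = 0 :=
  sphereMoment_eq_zero i i i l hi hi hi

lemma sphereMoment_swap [DecidableEq ι] (i j k l a b : ι) (h : a ≠ b) :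
    sphereMoment (Equiv.swap a b i) (Equiv.swap a b j) (Equiv.swap a b k) (Equiv.swap a b l) =
      sphereMoment i j k l :=
  (integral_sphereUniform_swap a b h (fun u => u i * u j * u k * u l)).symm

lemma sphereMoment_diag_eq (i j : ι) : sphereMoment i i i i = sphereMoment j j j j := by
  classical
  by_cases h : i = j
  · rw [h]
  · simpa using sphereMoment_swap j j j j i j h

lemma sphereMoment_pair [Nonempty ι] (i j : ι) (hij : i ≠ j) :
    3 * sphereMoment i j i j = sphereMoment i i i i := by
  classical
  have h := integral_sphereUniform_pow_four_mix i j hij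
  have e1 : sphereMoment i i i i = ∫ u, ((u : EuclideanSpace ℝ ι) i) ^ 4 ∂(sphereUniform ι) := by
    unfold sphereMoment
    congr 1; ext u; ring
  have e2 : ∫ u, ((3 * (u : EuclideanSpace ℝ ι) i - 4 * (u : EuclideanSpace ℝ ι) j) / 5) ^ 4
        ∂(sphereUniform ι) = 81 / 625 * sphereMoment i i i i - 432 / 625 * sphereMoment i i i j
        + 864 / 625 * sphereMoment i j i j - 768 / 625 * sphereMoment j j j i
        + 256 / 625 * sphereMoment j j j j := by
    unfold sphereMoment
    simp only [← integral_const_mul]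
    rw [← integral_sub, ← integral_add, ← integral_sub, ← integral_add]
    · congr 1; ext u; ring
    all_goals exact integrable_sphereUniform (by fun_prop)
  have e3 := sphereMoment_odd i j hij
  have e4 := sphereMoment_odd j i hij.symm
  have e5 := sphereMoment_diag_eq i j
  linarith

lemma sum_sphereMoment [Nonempty ι] : ∑ i : ι, ∑ j : ι, sphereMoment i j i j = 1 := by
  unfold sphereMoment
  simp_rw [← integral_finsetSum _ (fun j _ => integrable_sphereMoment _ j _ j)]
  rw [← integral_finsetSum _
    (fun i _ => integrable_finsetSum _ (fun j _ => integrable_sphereMoment i j i j))]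
  have : ∀ u : Metric.sphere (0 : EuclideanSpace ℝ ι) 1,
      ∑ i : ι, ∑ j : ι, (u : EuclideanSpace ℝ ι) i * (u : EuclideanSpace ℝ ι) j *
        (u : EuclideanSpace ℝ ι) i * (u : EuclideanSpace ℝ ι) j = 1 := by
    intro u
    have hu : ∑ i, (u : EuclideanSpace ℝ ι) i ^ 2 = 1 := by
      rw [← EuclideanSpace.real_norm_sq_eq]
      simp
    calc _ = (∑ i, (u : EuclideanSpace ℝ ι) i ^ 2) * ∑ i, (u : EuclideanSpace ℝ ι) i ^ 2 := by
          rw [Finset.sum_mul_sum]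
          refine Finset.sum_congr rfl fun i _ => Finset.sum_congr rfl fun j _ => by ring
      _ = 1 := by rw [hu]; norm_num
  simp [this]

lemma sphereMoment_diag_nonneg (i : ι) : 0 ≤ sphereMoment i i i i :=
  integral_nonneg fun u => by
    have := sq_nonneg ((u : EuclideanSpace ℝ ι) i ^ 2)
    simp only [Pi.zero_apply]
    linarith

lemma sphereMoment_diag_le [Nonempty ι] (i : ι) :
    sphereMoment i i i i ≤ 3 / (Fintype.card ι : ℝ) ^ 2 := by
  classical
  have hN : (0 : ℝ) < Fintype.card ι := by exact_mod_cast Fintype.card_pos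
  rw [le_div_iff₀ (by positivity)]
  have h : ∑ j : ι, ∑ k : ι, sphereMoment i i i i / 3 ≤ ∑ j : ι, ∑ k : ι, sphereMoment j k j k := by
    refine Finset.sum_le_sum fun j _ => Finset.sum_le_sum fun k _ => ?_
    have h0 := sphereMoment_diag_nonneg i
    by_cases hjk : j = k
    · subst hjk
      rw [sphereMoment_diag_eq j i]
      linarith
    · have := sphereMoment_pair j k hjk
      rw [sphereMoment_diag_eq j i] at this
      linarith
  rw [sum_sphereMoment] at h
  simp only [Finset.sum_const, Finset.card_univ, nsmul_eq_mul] at h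
  nlinarith

lemma sphereMoment_pair_le [Nonempty ι] (i j : ι) :
    sphereMoment i j i j ≤ 3 / (Fintype.card ι : ℝ) ^ 2 := by
  by_cases h : i = j
  · subst h
    exact sphereMoment_diag_le i
  · have h1 := sphereMoment_pair i j h
    have h2 := sphereMoment_diag_le i
    have h3 := sphereMoment_diag_nonneg i
    linarith

lemma sphereMoment_off_diag (i j k l : ι) (hij : i ≠ j) (hkl : k ≠ l)
    (h1 : ¬ (k = i ∧ l = j)) (h2 : ¬ (k = j ∧ l = i)) : sphereMoment i j k l = 0 := by
  by_cases hl : l = i ∨ l = j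
  · have : sphereMoment i j k l = sphereMoment i j l k := by
      unfold sphereMoment
      congr 1; ext u; ring
    rw [this]
    apply sphereMoment_eq_zero
    · rintro rfl
      rcases hl with rfl | rfl
      · exact hkl rfl
      · exact h1 ⟨rfl, rfl⟩
    · rintro rfl
      rcases hl with rfl | rfl
      · exact h2 ⟨rfl, rfl⟩
      · exact hkl rfl
    · exact hkl.symm
  · push Not at hl
    exact sphereMoment_eq_zero _ _ _ _ hl.1.symm hl.2.symm hkl

lemma integral_sphereUniform_quadratic_sq_le [Nonempty ι] (g : ι → ι → ℝ)
    (hsymm : ∀ i j, g i j = g j i) (hdiag : ∀ i, g i i = 0) :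
    ∫ u, (∑ i, ∑ j, g i j * ((u : EuclideanSpace ℝ ι) i * (u : EuclideanSpace ℝ ι) j)) ^ 2
        ∂(sphereUniform ι) ≤ 6 / (Fintype.card ι : ℝ) ^ 2 * ∑ i, ∑ j, g i j ^ 2 := by
  classical
  have hexp : ∀ u : Metric.sphere (0 : EuclideanSpace ℝ ι) 1,
      (∑ i, ∑ j, g i j * ((u : EuclideanSpace ℝ ι) i * (u : EuclideanSpace ℝ ι) j)) ^ 2 =
      ∑ i, ∑ j, ∑ k, ∑ l, g i j * g k l * ((u : EuclideanSpace ℝ ι) i *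
        (u : EuclideanSpace ℝ ι) j * (u : EuclideanSpace ℝ ι) k * (u : EuclideanSpace ℝ ι) l) := by
    intro u
    rw [sq, Finset.sum_mul]
    refine Finset.sum_congr rfl fun i _ => ?_
    rw [Finset.sum_mul]
    refine Finset.sum_congr rfl fun j _ => ?_
    rw [Finset.mul_sum]
    refine Finset.sum_congr rfl fun k _ => ?_
    rw [Finset.mul_sum]
    exact Finset.sum_congr rfl fun l _ => by ring
  have h_int : ∀ i j k l, Integrable (fun u : Metric.sphere (0 : EuclideanSpace ℝ ι) 1 =>
      g i j * g k l * ((u : EuclideanSpace ℝ ι) i *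
        (u : EuclideanSpace ℝ ι) j * (u : EuclideanSpace ℝ ι) k * (u : EuclideanSpace ℝ ι) l))
      (sphereUniform ι) := fun i j k l => (integrable_sphereMoment i j k l).const_mul _
  simp_rw [hexp]
  rw [integral_finsetSum _ fun i _ => integrable_finsetSum _ fun j _ =>
    integrable_finsetSum _ fun k _ => integrable_finsetSum _ fun l _ => h_int i j k l,
    Finset.mul_sum]
  refine Finset.sum_le_sum fun i _ => ?_
  rw [integral_finsetSum _ fun j _ =>
    integrable_finsetSum _ fun k _ => integrable_finsetSum _ fun l _ => h_int i j k l,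
    Finset.mul_sum]
  refine Finset.sum_le_sum fun j _ => ?_
  rw [integral_finsetSum _ fun k _ => integrable_finsetSum _ fun l _ => h_int i j k l]
  simp_rw [integral_finsetSum Finset.univ fun l _ => h_int i j _ l, integral_const_mul]
  have key : ∀ k l, g i j * g k l * sphereMoment i j k l =
      (if k = i then (if l = j then g i j ^ 2 * sphereMoment i j i j else 0) else 0) +
      (if k = j then (if l = i then g i j ^ 2 * sphereMoment i j i j else 0) else 0) := by
    intro k l
    by_cases hij : i = j
    · subst hij
      simp [hdiag]
    by_cases hkl : k = l
    · subst hkl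
      rw [hdiag]
      by_cases h : k = i
      · subst h
        simp [hij]
      · simp [h]
    by_cases h1 : k = i ∧ l = j
    · obtain ⟨rfl, rfl⟩ := h1
      simp only [hij, if_true, if_false, add_zero]
      ring
    by_cases h2 : k = j ∧ l = i
    · obtain ⟨rfl, rfl⟩ := h2
      have : sphereMoment l k k l = sphereMoment l k l k := by
        unfold sphereMoment
        congr 1; ext u; ring
      rw [this, hsymm k l]
      simp only [hij, hkl, if_true, if_false, zero_add]
      ring
    · rw [sphereMoment_off_diag i j k l hij hkl h1 h2]
      by_cases ha : k = i
      · by_cases hb : k = j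
        · exact absurd (ha.symm.trans hb) hij
        · have : ¬ l = j := fun h => h1 ⟨ha, h⟩
          simp [this, hb]
      · by_cases hb : k = j
        · have : ¬ l = i := fun h => h2 ⟨hb, h⟩
          simp [this, ha]
        · simp [ha, hb]
  change ∑ k, ∑ l, g i j * g k l * sphereMoment i j k l ≤ _
  simp_rw [key, Finset.sum_add_distrib]
  have hs1 : ∀ a b : ι, ∑ k, ∑ l, (if k = a then (if l = b then
      g i j ^ 2 * sphereMoment i j i j else 0) else 0) = g i j ^ 2 * sphereMoment i j i j := by
    intro a b
    rw [Finset.sum_eq_single a, Finset.sum_eq_single b] <;> simp +contextual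
  rw [hs1, hs1]
  have := mul_le_mul_of_nonneg_left (sphereMoment_pair_le i j) (sq_nonneg (g i j))
  calc _ = 2 * (g i j ^ 2 * sphereMoment i j i j) := by ring
    _ ≤ 2 * (g i j ^ 2 * (3 / (Fintype.card ι : ℝ) ^ 2)) := by linarith
    _ = _ := by ring

end SphereMoments

section Stein

lemma integrable_exp_neg_sq_div_two : Integrable fun t : ℝ => rexp (-(t ^ 2 / 2)) := by
  have := integrable_exp_neg_mul_sq (b := 1 / 2) (by norm_num)
  refine this.congr (Filter.Eventually.of_forall fun t => ?_)
  simp only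
  ring_nf

lemma hasDerivAt_exp_neg_sq_div_two (t : ℝ) :
    HasDerivAt (fun t : ℝ => rexp (-(t ^ 2 / 2))) (-t * rexp (-(t ^ 2 / 2))) t := by
  have := (((hasDerivAt_id t).pow 2).div_const 2).neg.exp
  refine this.congr_deriv ?_
  simp
  ring

lemma integrable_mul_exp_neg_sq_div_two : Integrable fun t : ℝ => t * rexp (-(t ^ 2 / 2)) := by
  have := integrable_mul_exp_neg_mul_sq (b := 1 / 2) (by norm_num)
  refine this.congr (Filter.Eventually.of_forall fun t => ?_)
  simp only
  ring_nf

lemma tendsto_exp_neg_sq_div_two {l : Filter ℝ} (h : Filter.Tendsto (fun t : ℝ => t ^ 2) l .atTop) :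
    Filter.Tendsto (fun t : ℝ => rexp (-(t ^ 2 / 2))) l (nhds 0) :=
  Real.tendsto_exp_neg_atTop_nhds_zero.comp (h.atTop_div_const (by norm_num))

lemma integral_Ioi_mul_exp_neg_sq_div_two (x : ℝ) :
    ∫ t in Set.Ioi x, t * rexp (-(t ^ 2 / 2)) = rexp (-(x ^ 2 / 2)) := by
  have := integral_Ioi_of_hasDerivAt_of_tendsto' (a := x)
    (fun t _ => (hasDerivAt_exp_neg_sq_div_two t).neg)
    (by simpa using integrable_mul_exp_neg_sq_div_two.integrableOn)
    ((tendsto_exp_neg_sq_div_two (Filter.tendsto_pow_atTop (by norm_num))).neg)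
  simpa using this

lemma integral_Iic_mul_exp_neg_sq_div_two (x : ℝ) :
    ∫ t in Set.Iic x, -t * rexp (-(t ^ 2 / 2)) = rexp (-(x ^ 2 / 2)) := by
  have := integral_Iic_of_hasDerivAt_of_tendsto' (a := x)
    (fun t _ => (hasDerivAt_exp_neg_sq_div_two t))
    (by simpa using integrable_mul_exp_neg_sq_div_two.integrableOn)
    (tendsto_exp_neg_sq_div_two (by
      simpa using (Filter.tendsto_pow_atTop (α := ℝ) (n := 2) (by norm_num)).comp
        Filter.tendsto_neg_atBot_atTop |>.congr (fun x => by simp)))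
  simpa using this

lemma integral_gaussianReal_eq (h : ℝ → ℝ) :
    ∫ x, h x ∂(gaussianReal 0 1) = (√(2 * π))⁻¹ * ∫ t, h t * rexp (-(t ^ 2 / 2)) := by
  rw [integral_gaussianReal_eq_integral_smul (by norm_num), ← integral_const_mul]
  congr 1
  ext t
  simp [gaussianPDFReal]
  ring_nf

lemma abs_mul_integral_le (k : ℝ → ℝ) (hk : Continuous k) (hb : ∀ t, |k t| ≤ 1)
    (h0 : ∫ t, k t * rexp (-(t ^ 2 / 2)) = 0) (x : ℝ) :
    |x * ∫ t in Set.Iic x, k t * rexp (-(t ^ 2 / 2))| ≤ rexp (-(x ^ 2 / 2)) := by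
  have h_int : Integrable fun t => k t * rexp (-(t ^ 2 / 2)) :=
    integrable_exp_neg_sq_div_two.bdd_mul hk.aestronglyMeasurable
      (Filter.Eventually.of_forall hb)
  have hx : ∀ s : Set ℝ, MeasurableSet s → |∫ t in s, k t * rexp (-(t ^ 2 / 2))| ≤
      ∫ t in s, rexp (-(t ^ 2 / 2)) := by
    intro s hs
    refine abs_integral_le_integral_abs.trans ?_
    refine integral_mono h_int.abs.integrableOn integrable_exp_neg_sq_div_two.integrableOn ?_
    intro t
    simp only [abs_mul, Real.abs_exp]
    exact mul_le_of_le_one_left (Real.exp_nonneg _) (hb t)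
  rw [abs_mul]
  rcases le_total x 0 with h | h
  · rw [abs_of_nonpos h]
    refine (mul_le_mul_of_nonneg_left (hx _ measurableSet_Iic) (by linarith)).trans ?_
    rw [← integral_Iic_mul_exp_neg_sq_div_two, ← integral_const_mul]
    refine setIntegral_mono_on (integrable_exp_neg_sq_div_two.integrableOn.const_mul _)
      ?_ measurableSet_Iic fun t ht => ?_
    · simpa using integrable_mul_exp_neg_sq_div_two.integrableOn
    · exact mul_le_mul_of_nonneg_right (neg_le_neg ht) (Real.exp_nonneg _)
  · have : ∫ t in Set.Iic x, k t * rexp (-(t ^ 2 / 2)) =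
        -∫ t in Set.Ioi x, k t * rexp (-(t ^ 2 / 2)) := by
      rw [eq_neg_iff_add_eq_zero, intervalIntegral.integral_Iic_add_Ioi h_int.integrableOn
        h_int.integrableOn, h0]
    rw [this, abs_neg, abs_of_nonneg h]
    refine (mul_le_mul_of_nonneg_left (hx _ measurableSet_Ioi) h).trans ?_
    rw [← integral_Ioi_mul_exp_neg_sq_div_two, ← integral_const_mul]
    refine setIntegral_mono_on (integrable_exp_neg_sq_div_two.integrableOn.const_mul _)
      integrable_mul_exp_neg_sq_div_two.integrableOn measurableSet_Ioi fun t ht => ?_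
    exact mul_le_mul_of_nonneg_right (le_of_lt ht) (Real.exp_nonneg _)

/-- The Stein equation for a continuous test function with values in `[0, 1]`. -/
lemma exists_stein_solution (h : ℝ → ℝ) (hc : Continuous h) (h01 : ∀ x, h x ∈ Set.Icc (0 : ℝ) 1) :
    ∃ φ ψ : ℝ → ℝ, Continuous ψ ∧ (∀ x, HasDerivAt φ (ψ x) x) ∧
      (∀ x, ψ x - x * φ x = h x - ∫ y, h y ∂(gaussianReal 0 1)) ∧ ∀ x, |ψ x| ≤ 2 := by
  set c := ∫ y, h y ∂(gaussianReal 0 1) with hcdef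
  have hh_int : Integrable h (gaussianReal 0 1) :=
    Integrable.of_bound hc.aestronglyMeasurable 1 (Filter.Eventually.of_forall fun x => by
      rw [Real.norm_eq_abs, abs_le]; constructor <;> linarith [(h01 x).1, (h01 x).2])
  have hc0 : 0 ≤ c := integral_nonneg fun x => (h01 x).1
  have hc1 : c ≤ 1 := by
    have := integral_mono hh_int (integrable_const (1 : ℝ)) fun x => (h01 x).2
    simpa using this
  set k : ℝ → ℝ := fun x => h x - c with hkdef
  have hk : Continuous k := hc.sub continuous_const
  have hkb : ∀ t, |k t| ≤ 1 := fun t => by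
    rw [abs_le]; constructor <;> simp only [hkdef] <;> linarith [(h01 t).1, (h01 t).2]
  have hkint : Integrable fun t => k t * rexp (-(t ^ 2 / 2)) :=
    integrable_exp_neg_sq_div_two.bdd_mul hk.aestronglyMeasurable
      (Filter.Eventually.of_forall hkb)
  have hk0 : ∫ t, k t * rexp (-(t ^ 2 / 2)) = 0 := by
    have h1 : ∫ y, k y ∂(gaussianReal 0 1) = 0 := by
      simp only [hkdef]
      rw [integral_sub hh_int (integrable_const _)]
      simp [hcdef]
    rw [integral_gaussianReal_eq] at h1
    rcases mul_eq_zero.1 h1 with h2 | h2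
    · exact absurd h2 (by positivity)
    · exact h2
  set I : ℝ → ℝ := fun x => ∫ t in Set.Iic x, k t * rexp (-(t ^ 2 / 2)) with hI
  have hkcont : Continuous fun t => k t * rexp (-(t ^ 2 / 2)) := by fun_prop
  have hId : ∀ x, HasDerivAt I (k x * rexp (-(x ^ 2 / 2))) x := by
    intro x
    have h1 : HasDerivAt (fun x => (∫ t in (0 : ℝ)..x, k t * rexp (-(t ^ 2 / 2))) + I 0)
        (k x * rexp (-(x ^ 2 / 2))) x :=
      ((hkcont.integral_hasStrictDerivAt 0 x).hasDerivAt).add_const _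
    refine h1.congr_of_eventuallyEq (Filter.Eventually.of_forall fun y => ?_)
    simp only [hI]
    rw [← intervalIntegral.integral_Iic_sub_Iic hkint.integrableOn hkint.integrableOn]
    ring
  set φ : ℝ → ℝ := fun x => rexp (x ^ 2 / 2) * I x with hφ
  have hφd : ∀ x, HasDerivAt φ (x * φ x + k x) x := by
    intro x
    have h1 : HasDerivAt (fun t : ℝ => rexp (t ^ 2 / 2)) (x * rexp (x ^ 2 / 2)) x := by
      refine (((hasDerivAt_id x).pow 2).div_const 2).exp.congr_deriv ?_
      simp
      ring
    refine (h1.mul (hId x)).congr_deriv ?_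
    have h2 : rexp (x ^ 2 / 2) * rexp (-(x ^ 2 / 2)) = 1 := by rw [← Real.exp_add]; simp
    simp only [hφ]
    linear_combination k x * h2
  refine ⟨φ, fun x => x * φ x + k x, ?_, hφd, fun x => by simp only [hkdef]; ring, fun x => ?_⟩
  · have : Continuous φ := continuous_iff_continuousAt.2 fun x => (hφd x).continuousAt
    fun_prop
  · have h1 : |x * φ x| ≤ 1 := by
      have h2 := abs_mul_integral_le k hk hkb hk0 x
      have h3 : x * φ x = rexp (x ^ 2 / 2) * (x * I x) := by simp only [hφ]; ring
      rw [h3, abs_mul, Real.abs_exp]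
      calc _ ≤ rexp (x ^ 2 / 2) * rexp (-(x ^ 2 / 2)) :=
            mul_le_mul_of_nonneg_left h2 (Real.exp_nonneg _)
        _ = 1 := by rw [← Real.exp_add]; simp
    calc _ ≤ |x * φ x| + |k x| := abs_add_le _ _
      _ ≤ 2 := by linarith [hkb x]

/-- To bound the total variation distance it suffices to consider continuous test functions. -/
lemma dTV_le_of_continuous (μ ν : Measure ℝ) [IsProbabilityMeasure μ] [IsProbabilityMeasure ν]
    (K : ℝ) (H : ∀ h : ℝ → ℝ, Continuous h → (∀ x, h x ∈ Set.Icc (0 : ℝ) 1) →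
      |∫ x, h x ∂μ - ∫ x, h x ∂ν| ≤ K) : dTV μ ν ≤ K := by
  refine ciSup_le fun ⟨s, hs⟩ => ?_
  refine le_of_forall_pos_le_add fun ε hε => ?_
  have hsi : Integrable (s.indicator fun _ => (1 : ℝ)) (μ + ν) :=
    (integrable_const _).indicator hs
  obtain ⟨g, hg, hgi⟩ := hsi.exists_boundedContinuous_integral_sub_le hε
  set h : ℝ → ℝ := fun x => max 0 (min 1 (g x)) with hh
  have hcont : Continuous h := by fun_prop
  have h01 : ∀ x, h x ∈ Set.Icc (0 : ℝ) 1 := fun x =>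
    ⟨le_max_left _ _, max_le zero_le_one (min_le_left _ _)⟩
  have hle : ∀ x, |s.indicator (fun _ => (1 : ℝ)) x - h x| ≤
      ‖s.indicator (fun _ => (1 : ℝ)) x - g x‖ := by
    intro x
    rw [Real.norm_eq_abs]
    by_cases hx : x ∈ s
    · simp only [hx, Set.indicator_of_mem, hh]
      rcases le_total 1 (g x) with h1 | h1 <;> rcases le_total 0 (g x) with h2 | h2
      · simp [h1]
      · linarith
      · simp [h1, h2]
      · simp only [min_eq_right h1, max_eq_left h2]
        rw [abs_of_nonneg (by norm_num), abs_of_nonneg (by linarith)]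
        linarith
    · simp only [hx, not_false_eq_true, Set.indicator_of_notMem, hh]
      rcases le_total 1 (g x) with h1 | h1 <;> rcases le_total 0 (g x) with h2 | h2
      · simp only [min_eq_left h1, max_eq_right zero_le_one, zero_sub, abs_neg, abs_of_nonneg h2]
        simpa using h1
      · linarith
      · simp [h1, h2]
      · simp [h1, h2]
  have h_int : ∀ ρ : Measure ℝ, IsProbabilityMeasure ρ → Integrable h ρ := fun ρ _ =>
    Integrable.of_bound hcont.aestronglyMeasurable 1 (Filter.Eventually.of_forall fun x => by
      rw [Real.norm_eq_abs, abs_le]; constructor <;> linarith [(h01 x).1, (h01 x).2])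
  have hdiff : ∀ ρ : Measure ℝ, IsProbabilityMeasure ρ → |(ρ s).toReal - ∫ x, h x ∂ρ| ≤
      ∫ x, |s.indicator (fun _ => (1 : ℝ)) x - h x| ∂ρ := by
    intro ρ _
    have : (ρ s).toReal = ∫ x, s.indicator (fun _ => (1 : ℝ)) x ∂ρ := by
      rw [integral_indicator_const _ hs]; simp [Measure.real]
    rw [this, ← integral_sub ((integrable_const _).indicator hs) (h_int ρ inferInstance)]
    exact abs_integral_le_integral_abs
  have hi : ∀ ρ : Measure ℝ, IsProbabilityMeasure ρ →
      Integrable (fun x => |s.indicator (fun _ => (1 : ℝ)) x - h x|) ρ := fun ρ _ =>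
    (((integrable_const _).indicator hs).sub (h_int ρ inferInstance)).abs
  have hsum : ∫ x, |s.indicator (fun _ => (1 : ℝ)) x - h x| ∂μ +
      ∫ x, |s.indicator (fun _ => (1 : ℝ)) x - h x| ∂ν ≤ ε := by
    rw [← integral_add_measure (hi μ inferInstance) (hi ν inferInstance)]
    refine le_trans (integral_mono ((hi μ inferInstance).add_measure (hi ν inferInstance))
      (hsi.sub hgi).norm hle) hg
  have h1 := abs_le.1 (hdiff μ inferInstance)
  have h2 := abs_le.1 (hdiff ν inferInstance)
  have h3 := abs_le.1 (H h hcont h01)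
  rw [abs_le]
  constructor <;> linarith [h1.1, h1.2, h2.1, h2.2, h3.1, h3.2]

end Stein

section Torus

lemma torusMeasure_eq_restrict_Icc (n : ℕ) :
    torusMeasure n = volume.restrict (Set.univ.pi fun _ : Fin n => Set.Icc (0 : ℝ) 1) := by
  refine Measure.restrict_congr_set ?_
  exact Measure.ae_eq_set_pi fun _ _ => Ico_ae_eq_Icc

instance isProbabilityMeasure_torusMeasure (n : ℕ) : IsProbabilityMeasure (torusMeasure n) := by
  constructor
  rw [torusMeasure, Measure.restrict_apply_univ, volume_pi_pi]
  simp

lemma integrable_torusMeasure {n : ℕ} {F : (Fin n → ℝ) → ℝ} (hF : Continuous F) :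
    Integrable F (torusMeasure n) := by
  rw [torusMeasure_eq_restrict_Icc]
  exact hF.continuousOn.integrableOn_compact (isCompact_univ_pi fun _ => isCompact_Icc)

/-- The integral over the torus of a partial derivative of a periodic function vanishes. -/
lemma integral_torusMeasure_deriv {n : ℕ} (k : Fin n) (F F' : (Fin n → ℝ) → ℝ)
    (hF : ∀ x, HasDerivAt (fun s => F (Function.update x k s)) (F' x) (x k))
    (hF' : Continuous F')
    (hper : ∀ x, F (Function.update x k 1) = F (Function.update x k 0)) :
    ∫ x, F' x ∂(torusMeasure n) = 0 := by
  obtain ⟨m, rfl⟩ : ∃ m, n = m + 1 := ⟨n - 1, by have := k.pos; omega⟩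
  have e := (volume_preserving_piFinSuccAbove (fun _ : Fin (m + 1) => ℝ) k).symm
  have h_int := integrable_torusMeasure hF'
  unfold torusMeasure at h_int ⊢
  rw [← e.setIntegral_preimage_emb (MeasurableEquiv.measurableEmbedding _)]
  have h_int' := (e.integrableOn_comp_preimage (MeasurableEquiv.measurableEmbedding _)).2 h_int
  have hset : (MeasurableEquiv.piFinSuccAbove (fun _ : Fin (m + 1) => ℝ) k).symm ⁻¹'
      (Set.univ.pi fun _ => Set.Ico (0 : ℝ) 1) =
      Set.Ico (0 : ℝ) 1 ×ˢ (Set.univ.pi fun _ : Fin m => Set.Ico (0 : ℝ) 1) := by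
    ext ⟨t, y⟩
    simp only [Set.mem_preimage, Set.mem_univ_pi, Set.mem_prod]
    change (∀ i, (k.insertNth t y : Fin (m + 1) → ℝ) i ∈ Set.Ico (0 : ℝ) 1) ↔ _
    rw [Fin.forall_iff_succAbove k]
    simp
  rw [hset] at h_int' ⊢
  rw [Measure.volume_eq_prod] at h_int' ⊢
  rw [← setIntegral_prod_swap]
  refine (setIntegral_prod _ h_int'.swap).trans ?_
  refine (setIntegral_congr_fun (MeasurableSet.univ_pi fun _ => measurableSet_Ico)
    (g := fun _ => (0 : ℝ)) fun y _ => ?_).trans (by simp)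
  change ∫ t in Set.Ico (0 : ℝ) 1, F' (k.insertNth t y) = 0
  rw [integral_Ico_eq_integral_Ioc, ← intervalIntegral.integral_of_le zero_le_one]
  have hd : ∀ t ∈ Set.uIcc (0 : ℝ) 1, HasDerivAt (fun s => F (k.insertNth s y))
      (F' (k.insertNth t y)) t := by
    intro t _
    have := hF (k.insertNth t y)
    simpa [Fin.update_insertNth] using this
  have hc : Continuous fun t : ℝ => F' (k.insertNth t y) :=
    hF'.comp (Continuous.finInsertNth (A := fun _ => ℝ) k continuous_id continuous_const)
  have h1 := intervalIntegral.integral_eq_sub_of_hasDerivAt hd (hc.intervalIntegrable _ _)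
  have h2 := hper (k.insertNth 0 y)
  simp only [Fin.update_insertNth] at h2
  rw [h1, h2, sub_self]

end Torus

section TrigPoly

variable {ι : Type*} [Fintype ι] {n : ℕ}

lemma dotProduct_update_eq (w x : Fin n → ℝ) (k : Fin n) (s : ℝ) :
    w ⬝ᵥ Function.update x k s = w ⬝ᵥ x + w k * (s - x k) := by
  have : Function.update x k s = x + Pi.single k (s - x k) := by
    ext l
    by_cases h : l = k
    · subst h; simp
    · simp [h]
  rw [this, dotProduct_add, dotProduct_single]

lemma hasDerivAt_dotProduct_update (w x : Fin n → ℝ) (k : Fin n) :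
    HasDerivAt (fun s => 2 * π * (w ⬝ᵥ Function.update x k s)) (2 * π * w k) (x k) := by
  simp_rw [dotProduct_update_eq]
  simpa using ((((hasDerivAt_id (x k)).sub_const (x k)).const_mul (w k)).const_add
    (w ⬝ᵥ x)).const_mul (2 * π)

lemma hasDerivAt_cos_dotProduct_update (w x : Fin n → ℝ) (k : Fin n) :
    HasDerivAt (fun s => cos (2 * π * (w ⬝ᵥ Function.update x k s)))
      (-(2 * π * w k * sin (2 * π * (w ⬝ᵥ x)))) (x k) := by
  refine (hasDerivAt_dotProduct_update w x k).cos.congr_deriv ?_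
  simp
  ring

lemma hasDerivAt_sin_dotProduct_update (w x : Fin n → ℝ) (k : Fin n) :
    HasDerivAt (fun s => sin (2 * π * (w ⬝ᵥ Function.update x k s)))
      (2 * π * w k * cos (2 * π * (w ⬝ᵥ x))) (x k) := by
  refine (hasDerivAt_dotProduct_update w x k).sin.congr_deriv ?_
  simp
  ring

lemma two_pi_mul_dotProduct_update_one (w x : Fin n → ℝ) (k : Fin n) (m : ℤ) (hm : w k = m) :
    2 * π * (w ⬝ᵥ Function.update x k 1) =
      2 * π * (w ⬝ᵥ Function.update x k 0) + m * (2 * π) := by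
  rw [dotProduct_update_eq, dotProduct_update_eq, hm]
  ring

lemma cos_dotProduct_update_one (w x : Fin n → ℝ) (k : Fin n) (hw : ∃ m : ℤ, w k = m) :
    cos (2 * π * (w ⬝ᵥ Function.update x k 1)) = cos (2 * π * (w ⬝ᵥ Function.update x k 0)) := by
  obtain ⟨m, hm⟩ := hw
  rw [two_pi_mul_dotProduct_update_one w x k m hm, cos_add_int_mul_two_pi]

lemma sin_dotProduct_update_one (w x : Fin n → ℝ) (k : Fin n) (hw : ∃ m : ℤ, w k = m) :
    sin (2 * π * (w ⬝ᵥ Function.update x k 1)) = sin (2 * π * (w ⬝ᵥ Function.update x k 0)) := by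
  obtain ⟨m, hm⟩ := hw
  rw [two_pi_mul_dotProduct_update_one w x k m hm, sin_add_int_mul_two_pi]

lemma integral_cos_dotProduct_eq_zero (w : Fin n → ℝ) (hw : ∀ k, ∃ m : ℤ, w k = m) (h0 : w ≠ 0) :
    ∫ x, cos (2 * π * (w ⬝ᵥ x)) ∂(torusMeasure n) = 0 := by
  obtain ⟨k, hk⟩ := Function.ne_iff.1 h0
  simp only [Pi.zero_apply] at hk
  refine integral_torusMeasure_deriv k (fun x => sin (2 * π * (w ⬝ᵥ x)) / (2 * π * w k)) _
    (fun x => ?_) (by fun_prop) fun x => ?_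
  · refine ((hasDerivAt_sin_dotProduct_update w x k).div_const _).congr_deriv ?_
    field_simp
  · rw [sin_dotProduct_update_one w x k (hw k)]

/-- The real trigonometric polynomial with frequencies `V` and coefficients `a`. -/
noncomputable def trigPoly (V : ι → Fin n → ℝ) (a : ι → ℝ) (x : Fin n → ℝ) : ℝ :=
  ∑ i, a i * cos (2 * π * (V i ⬝ᵥ x))

/-- The squared gradient of `trigPoly V a`, divided by `8π²`. -/
noncomputable def gradEnergy (V : ι → Fin n → ℝ) (a : ι → ℝ) (x : Fin n → ℝ) : ℝ :=
  ∑ i, ∑ j, (V i ⬝ᵥ V j) / 2 * sin (2 * π * (V i ⬝ᵥ x)) * sin (2 * π * (V j ⬝ᵥ x)) * (a i * a j)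

lemma continuous_trigPoly (V : ι → Fin n → ℝ) (a : ι → ℝ) : Continuous (trigPoly V a) := by
  unfold trigPoly
  fun_prop

lemma continuous_gradEnergy (V : ι → Fin n → ℝ) (a : ι → ℝ) : Continuous (gradEnergy V a) := by
  unfold gradEnergy
  fun_prop

/-- Integration by parts against an eigenfunction of the Laplacian. -/
lemma integral_stein_trigPoly (V : ι → Fin n → ℝ) (hV : ∀ i k, ∃ m : ℤ, V i k = m)
    (hV2 : ∀ i, V i ⬝ᵥ V i = 2) (a : ι → ℝ) (φ ψ : ℝ → ℝ) (hψ : Continuous ψ)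
    (hφ : ∀ x, HasDerivAt φ (ψ x) x) :
    ∫ x, ψ (trigPoly V a x) * gradEnergy V a x ∂(torusMeasure n) =
      ∫ x, φ (trigPoly V a x) * trigPoly V a x ∂(torusMeasure n) := by
  have hφc : Continuous φ := continuous_iff_continuousAt.2 fun x => (hφ x).continuousAt
  have hf := continuous_trigPoly V a
  have hG : Continuous (gradEnergy V a) := continuous_gradEnergy V a
  set d : Fin n → (Fin n → ℝ) → ℝ := fun k x =>
    ∑ i, a i * -(2 * π * V i k * sin (2 * π * (V i ⬝ᵥ x))) with hd
  set d2 : Fin n → (Fin n → ℝ) → ℝ := fun k x =>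
    ∑ i, a i * -(2 * π * V i k * (2 * π * V i k * cos (2 * π * (V i ⬝ᵥ x)))) with hd2
  have hdc : ∀ k, Continuous (d k) := fun k => by simp only [hd]; fun_prop
  have hd2c : ∀ k, Continuous (d2 k) := fun k => by simp only [hd2]; fun_prop
  have hzero : ∀ k, ∫ x, (ψ (trigPoly V a x) * d k x * d k x + φ (trigPoly V a x) * d2 k x)
      ∂(torusMeasure n) = 0 := by
    intro k
    refine integral_torusMeasure_deriv k (fun x => φ (trigPoly V a x) * d k x) _
      (fun x => ?_) (by fun_prop) fun x => ?_
    · have h1 : HasDerivAt (fun s => trigPoly V a (Function.update x k s)) (d k x) (x k) :=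
        HasDerivAt.fun_sum fun i _ => (hasDerivAt_cos_dotProduct_update (V i) x k).const_mul (a i)
      have h2 : HasDerivAt (fun s => d k (Function.update x k s)) (d2 k x) (x k) :=
        HasDerivAt.fun_sum fun i _ => (((hasDerivAt_sin_dotProduct_update (V i) x k).const_mul
          (2 * π * V i k)).neg).const_mul (a i)
      have h3 : HasDerivAt (fun s => φ (trigPoly V a (Function.update x k s)))
          (ψ (trigPoly V a x) * d k x) (x k) := by
        refine HasDerivAt.comp (x k) (h₂ := φ) ?_ h1
        simpa using hφ (trigPoly V a x)
      simpa using h3.fun_mul h2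
    · simp only [trigPoly, hd]
      simp_rw [cos_dotProduct_update_one (V _) x k (hV _ k),
        sin_dotProduct_update_one (V _) x k (hV _ k)]
  have hsum : ∫ x, ∑ k, (ψ (trigPoly V a x) * d k x * d k x + φ (trigPoly V a x) * d2 k x)
      ∂(torusMeasure n) = 0 := by
    rw [integral_finsetSum _ fun k _ => integrable_torusMeasure (by fun_prop)]
    exact Finset.sum_eq_zero fun k _ => hzero k
  have hdd : ∀ x, ∑ k, d k x * d k x = 8 * π ^ 2 * gradEnergy V a x := by
    intro x
    simp only [hd, gradEnergy, Finset.sum_mul_sum]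
    simp only [Finset.mul_sum]
    rw [Finset.sum_comm]
    refine Finset.sum_congr rfl fun i _ => ?_
    rw [Finset.sum_comm]
    refine Finset.sum_congr rfl fun j _ => ?_
    simp only [dotProduct, Finset.sum_div, Finset.sum_mul, Finset.mul_sum]
    exact Finset.sum_congr rfl fun k _ => by ring
  have hdd2 : ∀ x, ∑ k, d2 k x = -(8 * π ^ 2 * trigPoly V a x) := by
    intro x
    simp only [hd2, trigPoly, Finset.mul_sum, ← Finset.sum_neg_distrib]
    rw [Finset.sum_comm]
    refine Finset.sum_congr rfl fun i _ => ?_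
    have : 8 * π ^ 2 * (a i * cos (2 * π * (V i ⬝ᵥ x))) =
        4 * π ^ 2 * (a i * cos (2 * π * (V i ⬝ᵥ x))) * (V i ⬝ᵥ V i) := by rw [hV2 i]; ring
    rw [this]
    conv_rhs => rw [show V i ⬝ᵥ V i = ∑ k, V i k * V i k from rfl]
    rw [Finset.mul_sum, ← Finset.sum_neg_distrib]
    exact Finset.sum_congr rfl fun k _ => by ring
  have h_int : ∀ x, ∑ k, (ψ (trigPoly V a x) * d k x * d k x + φ (trigPoly V a x) * d2 k x) =
      8 * π ^ 2 * (ψ (trigPoly V a x) * gradEnergy V a x -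
        φ (trigPoly V a x) * trigPoly V a x) := by
    intro x
    simp only [Finset.sum_add_distrib, mul_assoc, ← Finset.mul_sum]
    rw [hdd, hdd2]
    ring
  simp_rw [h_int] at hsum
  rw [integral_const_mul, integral_sub (integrable_torusMeasure (by fun_prop))
    (integrable_torusMeasure (by fun_prop))] at hsum
  have := (mul_eq_zero.1 hsum).resolve_left (by positivity)
  linarith

lemma dTV_trigPoly_le (V : ι → Fin n → ℝ) (hV : ∀ i k, ∃ m : ℤ, V i k = m)
    (hV2 : ∀ i, V i ⬝ᵥ V i = 2) (a : ι → ℝ) (s : ℝ) (hs : 0 < s) :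
    dTV (Measure.map (trigPoly V a) (torusMeasure n)) (gaussianReal 0 1) ≤
      s * (∫ x, (1 - gradEnergy V a x) ^ 2 ∂(torusMeasure n)) + 1 / s := by
  have hf := continuous_trigPoly V a
  have hG : Continuous (gradEnergy V a) := continuous_gradEnergy V a
  have : IsProbabilityMeasure (Measure.map (trigPoly V a) (torusMeasure n)) :=
    Measure.isProbabilityMeasure_map hf.aemeasurable
  refine dTV_le_of_continuous _ _ _ fun h hc h01 => ?_
  obtain ⟨φ, ψ, hψ, hφ, hst, hb⟩ := exists_stein_solution h hc h01
  have hφc : Continuous φ := continuous_iff_continuousAt.2 fun x => (hφ x).continuousAt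
  rw [integral_map hf.aemeasurable hc.aestronglyMeasurable]
  have h1 : ∫ x, h (trigPoly V a x) ∂(torusMeasure n) - ∫ y, h y ∂(gaussianReal 0 1) =
      ∫ x, ψ (trigPoly V a x) * (1 - gradEnergy V a x) ∂(torusMeasure n) := by
    have e1 : ∫ x, h (trigPoly V a x) ∂(torusMeasure n) - ∫ y, h y ∂(gaussianReal 0 1) =
        ∫ x, (h (trigPoly V a x) - ∫ y, h y ∂(gaussianReal 0 1)) ∂(torusMeasure n) := by
      rw [integral_sub (integrable_torusMeasure (by fun_prop)) (integrable_const _)]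
      simp
    rw [e1]
    simp_rw [← hst, mul_sub, mul_one]
    rw [integral_sub (integrable_torusMeasure (by fun_prop))
      (integrable_torusMeasure (by fun_prop)), integral_sub (integrable_torusMeasure (by fun_prop))
      (integrable_torusMeasure (by fun_prop)), integral_stein_trigPoly V hV hV2 a φ ψ hψ hφ]
    simp_rw [mul_comm]
  rw [h1]
  refine abs_integral_le_integral_abs.trans ?_
  have h2 : ∀ x, |ψ (trigPoly V a x) * (1 - gradEnergy V a x)| ≤
      s * (1 - gradEnergy V a x) ^ 2 + 1 / s := by
    intro x
    rw [abs_mul]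
    have h3 : 2 * |1 - gradEnergy V a x| ≤ s * (1 - gradEnergy V a x) ^ 2 + 1 / s := by
      rw [← sq_abs]
      have := mul_nonneg (one_div_pos.2 hs).le (sq_nonneg (s * |1 - gradEnergy V a x| - 1))
      have e : 1 / s * (s * |1 - gradEnergy V a x| - 1) ^ 2 =
        s * |1 - gradEnergy V a x| ^ 2 + 1 / s - 2 * |1 - gradEnergy V a x| := by
        field_simp
        ring
      linarith
    exact (mul_le_mul_of_nonneg_right (hb _) (abs_nonneg _)).trans h3
  refine (integral_mono (integrable_torusMeasure (by fun_prop))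
    (integrable_torusMeasure (by fun_prop)) h2).trans_eq ?_
  rw [integral_add (integrable_torusMeasure (by fun_prop)) (integrable_const _), integral_const_mul]
  simp

end TrigPoly

section Variance

variable {ι : Type*} [Fintype ι] {n : ℕ}

lemma integral_cos_mul_cos_eq_zero (v w : Fin n → ℝ) (hv : ∀ k, ∃ m : ℤ, v k = m)
    (hw : ∀ k, ∃ m : ℤ, w k = m) (hsub : v ≠ w) (hadd : v + w ≠ 0) :
    ∫ x, cos (2 * (2 * π * (v ⬝ᵥ x))) * cos (2 * (2 * π * (w ⬝ᵥ x))) ∂(torusMeasure n) = 0 := by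
  have h : ∀ x : Fin n → ℝ, cos (2 * (2 * π * (v ⬝ᵥ x))) * cos (2 * (2 * π * (w ⬝ᵥ x))) =
      2⁻¹ * (cos (2 * π * (((2 : ℝ) • (v - w)) ⬝ᵥ x)) +
        cos (2 * π * (((2 : ℝ) • (v + w)) ⬝ᵥ x))) := by
    intro x
    simp only [smul_dotProduct, sub_dotProduct, add_dotProduct, smul_eq_mul]
    rw [show 2 * π * (2 * (v ⬝ᵥ x - w ⬝ᵥ x)) = 2 * (2 * π * (v ⬝ᵥ x)) - 2 * (2 * π * (w ⬝ᵥ x)) by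
      ring, show 2 * π * (2 * (v ⬝ᵥ x + w ⬝ᵥ x)) =
      2 * (2 * π * (v ⬝ᵥ x)) + 2 * (2 * π * (w ⬝ᵥ x)) by ring, cos_sub, cos_add]
    ring
  simp_rw [h]
  rw [integral_const_mul, integral_add (integrable_torusMeasure (by fun_prop))
    (integrable_torusMeasure (by fun_prop)), integral_cos_dotProduct_eq_zero,
    integral_cos_dotProduct_eq_zero]
  · simp
  · intro k
    obtain ⟨a, ha⟩ := hv k
    obtain ⟨b, hb⟩ := hw k
    exact ⟨2 * (a + b), by simp [ha, hb]⟩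
  · exact smul_ne_zero two_ne_zero hadd
  · intro k
    obtain ⟨a, ha⟩ := hv k
    obtain ⟨b, hb⟩ := hw k
    exact ⟨2 * (a - b), by simp [ha, hb]⟩
  · exact smul_ne_zero two_ne_zero (sub_ne_zero.2 hsub)

lemma integral_sum_cos_sq_le (V : ι → Fin n → ℝ) (hV : ∀ i k, ∃ m : ℤ, V i k = m)
    (hsub : Function.Injective V) (hadd : ∀ i j, V i + V j ≠ 0) (b : ι → ℝ) :
    ∫ x, (∑ i, b i * cos (2 * (2 * π * (V i ⬝ᵥ x)))) ^ 2 ∂(torusMeasure n) ≤ ∑ i, b i ^ 2 := by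
  classical
  have hexp : ∀ x : Fin n → ℝ, (∑ i, b i * cos (2 * (2 * π * (V i ⬝ᵥ x)))) ^ 2 =
      ∑ i, ∑ j, b i * b j *
        (cos (2 * (2 * π * (V i ⬝ᵥ x))) * cos (2 * (2 * π * (V j ⬝ᵥ x)))) := by
    intro x
    rw [sq, Finset.sum_mul_sum]
    exact Finset.sum_congr rfl fun i _ => Finset.sum_congr rfl fun j _ => by ring
  simp_rw [hexp]
  rw [integral_finsetSum _ fun i _ => integrable_torusMeasure (by fun_prop)]
  refine Finset.sum_le_sum fun i _ => ?_
  rw [integral_finsetSum _ fun j _ => integrable_torusMeasure (by fun_prop),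
    Finset.sum_eq_single i]
  · rw [integral_const_mul, ← sq]
    refine mul_le_of_le_one_right (sq_nonneg _) ?_
    refine (integral_mono (g := fun _ => (1 : ℝ)) (integrable_torusMeasure (by fun_prop))
      (integrable_const _) fun x => ?_).trans_eq (by simp)
    simp only
    rw [← sq]
    exact cos_sq_le_one _
  · intro j _ hj
    rw [integral_const_mul, integral_cos_mul_cos_eq_zero _ _ (hV i) (hV j)
      (fun h => hj (hsub h).symm) (hadd i j), mul_zero]
  · simp

/-- The off-diagonal part of the kernel of the quadratic form `gradEnergy V · x`. -/
noncomputable def offDiagKernel [DecidableEq ι] (V : ι → Fin n → ℝ) (x : Fin n → ℝ) (i j : ι) : ℝ :=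
  if i = j then 0 else
    (V i ⬝ᵥ V j) / 2 * sin (2 * π * (V i ⬝ᵥ x)) * sin (2 * π * (V j ⬝ᵥ x))

omit [Fintype ι] in
@[fun_prop]
lemma continuous_offDiagKernel [DecidableEq ι] (V : ι → Fin n → ℝ) (i j : ι) :
    Continuous fun x => offDiagKernel V x i j := by
  unfold offDiagKernel
  split_ifs <;> fun_prop

lemma one_sub_gradEnergy [DecidableEq ι] (V : ι → Fin n → ℝ) (hV2 : ∀ i, V i ⬝ᵥ V i = 2)
    (a : ι → ℝ) (ha : ∑ i, a i ^ 2 = 2) (x : Fin n → ℝ) :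
    1 - gradEnergy V a x = 2⁻¹ * ∑ i, a i ^ 2 * cos (2 * (2 * π * (V i ⬝ᵥ x))) -
      ∑ i, ∑ j, offDiagKernel V x i j * (a i * a j) := by
  have h1 : ∑ i, a i ^ 2 * cos (2 * (2 * π * (V i ⬝ᵥ x))) =
      ∑ i, a i ^ 2 - 2 * ∑ i, a i ^ 2 * sin (2 * π * (V i ⬝ᵥ x)) ^ 2 := by
    rw [Finset.mul_sum, ← Finset.sum_sub_distrib]
    refine Finset.sum_congr rfl fun i _ => ?_
    rw [cos_two_mul, cos_sq']
    ring
  have h2 : gradEnergy V a x = ∑ i, a i ^ 2 * sin (2 * π * (V i ⬝ᵥ x)) ^ 2 +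
      ∑ i, ∑ j, offDiagKernel V x i j * (a i * a j) := by
    unfold gradEnergy
    rw [← Finset.sum_add_distrib]
    refine Finset.sum_congr rfl fun i _ => ?_
    have h3 : a i ^ 2 * sin (2 * π * (V i ⬝ᵥ x)) ^ 2 =
        ∑ j, if i = j then a i ^ 2 * sin (2 * π * (V i ⬝ᵥ x)) ^ 2 else 0 := by simp
    rw [h3, ← Finset.sum_add_distrib]
    refine Finset.sum_congr rfl fun j _ => ?_
    by_cases hij : i = j
    · subst hij
      simp only [offDiagKernel, if_true, hV2]
      ring
    · simp [offDiagKernel, hij]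
  rw [h1, h2, ha]
  ring

lemma integral_one_sub_gradEnergy_sq_le [DecidableEq ι] (V : ι → Fin n → ℝ)
    (hV : ∀ i k, ∃ m : ℤ, V i k = m) (hV2 : ∀ i, V i ⬝ᵥ V i = 2)
    (hsub : Function.Injective V) (hadd : ∀ i j, V i + V j ≠ 0)
    (a : ι → ℝ) (ha : ∑ i, a i ^ 2 = 2) :
    ∫ x, (1 - gradEnergy V a x) ^ 2 ∂(torusMeasure n) ≤ 2⁻¹ * ∑ i, a i ^ 4 +
      2 * ∫ x, (∑ i, ∑ j, offDiagKernel V x i j * (a i * a j)) ^ 2 ∂(torusMeasure n) := by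
  have h1 := integral_sum_cos_sq_le V hV hsub hadd fun i => a i ^ 2
  have h2 : ∑ i, (a i ^ 2) ^ 2 = ∑ i, a i ^ 4 :=
    Finset.sum_congr rfl fun i _ => by ring
  rw [h2] at h1
  have hG := continuous_gradEnergy V a
  have h3 : ∫ x, (1 - gradEnergy V a x) ^ 2 ∂(torusMeasure n) ≤
      ∫ x, (2⁻¹ * (∑ i, a i ^ 2 * cos (2 * (2 * π * (V i ⬝ᵥ x)))) ^ 2 +
        2 * (∑ i, ∑ j, offDiagKernel V x i j * (a i * a j)) ^ 2) ∂(torusMeasure n) := by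
    refine integral_mono (integrable_torusMeasure (by fun_prop))
      (integrable_torusMeasure (by fun_prop)) fun x => ?_
    simp only
    rw [one_sub_gradEnergy V hV2 a ha]
    set A := ∑ i, a i ^ 2 * cos (2 * (2 * π * (V i ⬝ᵥ x)))
    set B := ∑ i, ∑ j, offDiagKernel V x i j * (a i * a j)
    nlinarith [sq_nonneg (2⁻¹ * A + B)]
  rw [integral_add (integrable_torusMeasure (by fun_prop)) (integrable_torusMeasure (by fun_prop)),
    integral_const_mul, integral_const_mul] at h3
  linarith

lemma sum_offDiagKernel_sq_le [DecidableEq ι] (V : ι → Fin n → ℝ) (x : Fin n → ℝ) :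
    ∑ i, ∑ j, offDiagKernel V x i j ^ 2 ≤ (∑ i, ∑ j, (V i ⬝ᵥ V j) ^ 2) / 4 := by
  rw [Finset.sum_div]
  refine Finset.sum_le_sum fun i _ => ?_
  rw [Finset.sum_div]
  refine Finset.sum_le_sum fun j _ => ?_
  unfold offDiagKernel
  split_ifs
  · rw [zero_pow two_ne_zero]
    positivity
  · have h1 := sin_sq_le_one (2 * π * (V i ⬝ᵥ x))
    have h2 := sin_sq_le_one (2 * π * (V j ⬝ᵥ x))
    have h3 := mul_le_one₀ h1 (sq_nonneg _) h2
    calc _ = (V i ⬝ᵥ V j) ^ 2 / 4 *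
          (sin (2 * π * (V i ⬝ᵥ x)) ^ 2 * sin (2 * π * (V j ⬝ᵥ x)) ^ 2) := by ring
      _ ≤ _ := mul_le_of_le_one_right (by positivity) h3

lemma integrable_offDiagKernel_prod [DecidableEq ι] [Nonempty ι] (V : ι → Fin n → ℝ) :
    Integrable (fun p : Metric.sphere (0 : EuclideanSpace ℝ ι) 1 × (Fin n → ℝ) =>
      (∑ i, ∑ j, offDiagKernel V p.2 i j *
        ((p.1 : EuclideanSpace ℝ ι) i * (p.1 : EuclideanSpace ℝ ι) j)) ^ 2)
      ((sphereUniform ι).prod (torusMeasure n)) := by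
  have hk : ∀ i j, Continuous fun p : Metric.sphere (0 : EuclideanSpace ℝ ι) 1 × (Fin n → ℝ) =>
      offDiagKernel V p.2 i j := fun i j => (continuous_offDiagKernel V i j).comp continuous_snd
  have hcont : Continuous (fun p : Metric.sphere (0 : EuclideanSpace ℝ ι) 1 × (Fin n → ℝ) =>
      (∑ i, ∑ j, offDiagKernel V p.2 i j *
        ((p.1 : EuclideanSpace ℝ ι) i * (p.1 : EuclideanSpace ℝ ι) j)) ^ 2) := by fun_prop
  rw [torusMeasure_eq_restrict_Icc, ← Measure.restrict_univ (μ := sphereUniform ι),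
    Measure.prod_restrict]
  exact hcont.continuousOn.integrableOn_compact
    (isCompact_univ.prod (isCompact_univ_pi fun _ => isCompact_Icc))

lemma integral_dTV_trigPoly_le [Nonempty ι] (V : ι → Fin n → ℝ)
    (hV : ∀ i k, ∃ m : ℤ, V i k = m) (hV2 : ∀ i, V i ⬝ᵥ V i = 2)
    (hsub : Function.Injective V) (hadd : ∀ i j, V i + V j ≠ 0) (s : ℝ) (hs : 0 < s) :
    ∫ u, dTV (Measure.map (trigPoly V fun i => √2 * (u : EuclideanSpace ℝ ι) i) (torusMeasure n))
        (gaussianReal 0 1) ∂(sphereUniform ι) ≤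
      s * (6 / Fintype.card ι + 12 * (∑ i, ∑ j, (V i ⬝ᵥ V j) ^ 2) / (Fintype.card ι : ℝ) ^ 2) +
        1 / s := by
  classical
  have hN : (0 : ℝ) < Fintype.card ι := by exact_mod_cast Fintype.card_pos
  have hprod := integrable_offDiagKernel_prod (ι := ι) V
  have hI : Integrable (fun u : Metric.sphere (0 : EuclideanSpace ℝ ι) 1 =>
      ∫ x, (∑ i, ∑ j, offDiagKernel V x i j *
        ((u : EuclideanSpace ℝ ι) i * (u : EuclideanSpace ℝ ι) j)) ^ 2 ∂(torusMeasure n))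
      (sphereUniform ι) := hprod.integral_prod_left
  have h4 : Integrable (fun u : Metric.sphere (0 : EuclideanSpace ℝ ι) 1 =>
      ∑ i, (u : EuclideanSpace ℝ ι) i ^ 4) (sphereUniform ι) :=
    integrable_sphereUniform (by fun_prop)
  have hbound : ∀ u : Metric.sphere (0 : EuclideanSpace ℝ ι) 1,
      dTV (Measure.map (trigPoly V fun i => √2 * (u : EuclideanSpace ℝ ι) i) (torusMeasure n))
        (gaussianReal 0 1) ≤ s * (2 * ∑ i, (u : EuclideanSpace ℝ ι) i ^ 4 +
        8 * ∫ x, (∑ i, ∑ j, offDiagKernel V x i j *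
          ((u : EuclideanSpace ℝ ι) i * (u : EuclideanSpace ℝ ι) j)) ^ 2 ∂(torusMeasure n)) +
        1 / s := by
    intro u
    refine (dTV_trigPoly_le V hV hV2 _ s hs).trans ?_
    gcongr
    have h2 : (√2 : ℝ) ^ 2 = 2 := Real.sq_sqrt (by norm_num)
    refine (integral_one_sub_gradEnergy_sq_le V hV hV2 hsub hadd _ ?_).trans_eq ?_
    · simp_rw [mul_pow, h2]
      rw [← Finset.mul_sum, ← EuclideanSpace.real_norm_sq_eq]
      simp
    · have e1 : ∀ i, (√2 * (u : EuclideanSpace ℝ ι) i) ^ 4 =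
          4 * (u : EuclideanSpace ℝ ι) i ^ 4 := by
        intro i
        rw [mul_pow, show (√2 : ℝ) ^ 4 = ((√2 : ℝ) ^ 2) ^ 2 by ring, h2]
        norm_num
      have e2 : ∀ x : Fin n → ℝ, (∑ i, ∑ j, offDiagKernel V x i j *
          (√2 * (u : EuclideanSpace ℝ ι) i * (√2 * (u : EuclideanSpace ℝ ι) j))) ^ 2 =
          4 * (∑ i, ∑ j, offDiagKernel V x i j *
          ((u : EuclideanSpace ℝ ι) i * (u : EuclideanSpace ℝ ι) j)) ^ 2 := by
        intro x
        have : ∑ i, ∑ j, offDiagKernel V x i j *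
            (√2 * (u : EuclideanSpace ℝ ι) i * (√2 * (u : EuclideanSpace ℝ ι) j)) =
            2 * ∑ i, ∑ j, offDiagKernel V x i j *
            ((u : EuclideanSpace ℝ ι) i * (u : EuclideanSpace ℝ ι) j) := by
          simp only [Finset.mul_sum]
          refine Finset.sum_congr rfl fun i _ => Finset.sum_congr rfl fun j _ => ?_
          linear_combination (offDiagKernel V x i j *
            ((u : EuclideanSpace ℝ ι) i * (u : EuclideanSpace ℝ ι) j)) * h2
        rw [this]
        ring
      simp_rw [e1, e2]
      rw [← Finset.mul_sum, integral_const_mul]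
      ring
  have hsum : Integrable (fun u : Metric.sphere (0 : EuclideanSpace ℝ ι) 1 =>
      2 * ∑ i, (u : EuclideanSpace ℝ ι) i ^ 4 +
        8 * ∫ x, (∑ i, ∑ j, offDiagKernel V x i j *
          ((u : EuclideanSpace ℝ ι) i * (u : EuclideanSpace ℝ ι) j)) ^ 2 ∂(torusMeasure n))
      (sphereUniform ι) := (h4.const_mul 2).add (hI.const_mul 8)
  refine (integral_mono_of_nonneg
    (Filter.Eventually.of_forall fun u => Real.iSup_nonneg fun _ => abs_nonneg _)
    ((hsum.const_mul s).add (integrable_const (1 / s)))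
    (Filter.Eventually.of_forall hbound)).trans ?_
  have hsplit : ∫ u : Metric.sphere (0 : EuclideanSpace ℝ ι) 1,
      (s * (2 * ∑ i, (u : EuclideanSpace ℝ ι) i ^ 4 +
        8 * ∫ x, (∑ i, ∑ j, offDiagKernel V x i j *
          ((u : EuclideanSpace ℝ ι) i * (u : EuclideanSpace ℝ ι) j)) ^ 2 ∂(torusMeasure n)) +
        1 / s) ∂(sphereUniform ι) =
      s * (2 * ∫ u : Metric.sphere (0 : EuclideanSpace ℝ ι) 1,
          ∑ i, (u : EuclideanSpace ℝ ι) i ^ 4 ∂(sphereUniform ι) +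
        8 * ∫ u : Metric.sphere (0 : EuclideanSpace ℝ ι) 1, ∫ x, (∑ i, ∑ j, offDiagKernel V x i j *
          ((u : EuclideanSpace ℝ ι) i * (u : EuclideanSpace ℝ ι) j)) ^ 2 ∂(torusMeasure n)
          ∂(sphereUniform ι)) + 1 / s := by
    rw [integral_add (hsum.const_mul s) (integrable_const _),
      integral_const_mul, integral_add (h4.const_mul 2) (hI.const_mul 8), integral_const_mul,
      integral_const_mul]
    simp
  refine hsplit.trans_le ?_
  have b1 : ∫ u : Metric.sphere (0 : EuclideanSpace ℝ ι) 1,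
      ∑ i, (u : EuclideanSpace ℝ ι) i ^ 4 ∂(sphereUniform ι) ≤ 3 / Fintype.card ι := by
    rw [integral_finsetSum _ fun i _ => integrable_sphereUniform (by fun_prop)]
    have : ∀ i, ∫ u : Metric.sphere (0 : EuclideanSpace ℝ ι) 1,
        (u : EuclideanSpace ℝ ι) i ^ 4 ∂(sphereUniform ι) ≤ 3 / (Fintype.card ι : ℝ) ^ 2 := by
      intro i
      refine le_of_eq_of_le ?_ (sphereMoment_diag_le i)
      unfold sphereMoment
      congr 1; ext u; ring
    refine (Finset.sum_le_sum fun i _ => this i).trans_eq ?_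
    simp
    field_simp
  have b2 : ∫ u : Metric.sphere (0 : EuclideanSpace ℝ ι) 1, ∫ x, (∑ i, ∑ j, offDiagKernel V x i j *
        ((u : EuclideanSpace ℝ ι) i * (u : EuclideanSpace ℝ ι) j)) ^ 2 ∂(torusMeasure n)
        ∂(sphereUniform ι) ≤
      6 / (Fintype.card ι : ℝ) ^ 2 * ((∑ i, ∑ j, (V i ⬝ᵥ V j) ^ 2) / 4) := by
    rw [integral_integral_swap hprod]
    refine (integral_mono (g := fun _ => 6 / (Fintype.card ι : ℝ) ^ 2 *
      ((∑ i, ∑ j, (V i ⬝ᵥ V j) ^ 2) / 4)) hprod.integral_prod_right (integrable_const _)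
      fun x => ?_).trans_eq (by simp)
    refine (integral_sphereUniform_quadratic_sq_le (offDiagKernel V x) ?_ ?_).trans
      (mul_le_mul_of_nonneg_left (sum_offDiagKernel_sq_le V x) (by positivity))
    · intro i j
      unfold offDiagKernel
      by_cases h : i = j
      · simp [h]
      · rw [if_neg h, if_neg (Ne.symm h), dotProduct_comm]
        ring
    · intro i
      simp [offDiagKernel]
  have b3 : 6 / (Fintype.card ι : ℝ) +
      12 * (∑ i, ∑ j, (V i ⬝ᵥ V j) ^ 2) / (Fintype.card ι : ℝ) ^ 2 =
      2 * (3 / (Fintype.card ι : ℝ)) +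
      8 * (6 / (Fintype.card ι : ℝ) ^ 2 * ((∑ i, ∑ j, (V i ⬝ᵥ V j) ^ 2) / 4)) := by ring
  rw [b3, add_le_add_iff_right]
  exact mul_le_mul_of_nonneg_left (add_le_add (mul_le_mul_of_nonneg_left b1 two_pos.le)
    (mul_le_mul_of_nonneg_left b2 (by norm_num))) hs.le

end Variance

section PairSums

variable {n : ℕ}

lemma torusFun_one (𝒱 : Finset (Fin n → ℝ)) (a : ↥𝒱 → ℝ) :
    torusFun 1 𝒱 a = trigPoly (fun v : ↥𝒱 => (v : Fin n → ℝ)) a := by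
  ext x
  simp only [torusFun, trigPoly, Complex.re_sum, one_mulVec]
  refine Finset.sum_congr rfl fun v _ => ?_
  rw [Complex.re_ofReal_mul, ← Complex.exp_ofReal_mul_I_re]
  congr 3
  push_cast
  ring

lemma integral_coeffMeasure (𝒱 : Finset (Fin n → ℝ)) (F : (↥𝒱 → ℝ) → ℝ) :
    ∫ a, F a ∂(coeffMeasure 𝒱) =
      ∫ u, F (fun v => √2 * (u : EuclideanSpace ℝ ↥𝒱) v) ∂(sphereUniform ↥𝒱) := by
  have hemb : MeasurableEmbedding (fun c : Metric.sphere (0 : EuclideanSpace ℝ ↥𝒱) 1 =>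
      fun v => √2 * (c : EuclideanSpace ℝ ↥𝒱) v) := by
    refine (Continuous.isClosedEmbedding (by fun_prop) fun c d h => ?_).measurableEmbedding
    ext v
    exact mul_left_cancel₀ (by positivity) (congrFun h v)
  exact hemb.integral_map F

/-- The vector `e_i + e_j` attached to the pair `(i, j)`. -/
abbrev pairSum (p : Fin n × Fin n) : Fin n → ℝ := Pi.single p.1 1 + Pi.single p.2 1

/-- The pairs `(i, j)` with `i < j`. -/
abbrev ltPairs (n : ℕ) : Finset (Fin n × Fin n) := Finset.univ.filter fun p => p.1 < p.2

lemma pairSum_apply (p : Fin n × Fin n) (k : Fin n) :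
    pairSum p k = (if k = p.1 then 1 else 0) + if k = p.2 then 1 else 0 := by
  simp [pairSum, Pi.single_apply]

lemma pairSum_dotProduct (p : Fin n × Fin n) (w : Fin n → ℝ) :
    pairSum p ⬝ᵥ w = w p.1 + w p.2 := by
  simp [pairSum, add_dotProduct]

lemma injOn_pairSum : Set.InjOn pairSum (ltPairs n : Set (Fin n × Fin n)) := by
  rintro ⟨i, j⟩ hp ⟨k, l⟩ hq h
  simp only [Finset.coe_filter, Finset.mem_univ, true_and, Set.mem_ofPred_eq] at hp hq
  have h1 := congrFun h i
  have h2 := congrFun h j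
  have h3 := congrFun h k
  have h4 := congrFun h l
  simp only [pairSum_apply] at h1 h2 h3 h4
  grind

lemma pairSum_dotProduct_self {p : Fin n × Fin n} (hp : p.1 < p.2) :
    pairSum p ⬝ᵥ pairSum p = 2 := by
  rw [pairSum_dotProduct, pairSum_apply, pairSum_apply]
  simp [hp.ne, hp.ne']
  norm_num

lemma pairSum_add_ne_zero (p q : Fin n × Fin n) : pairSum p + pairSum q ≠ 0 := by
  intro h
  have h1 := congrFun h p.1
  rw [Pi.add_apply, pairSum_apply, pairSum_apply, Pi.zero_apply, if_pos rfl] at h1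
  split_ifs at h1 <;> norm_num at h1

lemma sq_le_four_mul_card_ltPairs (hn : 2 ≤ n) : (n : ℝ) ^ 2 ≤ 4 * #(ltPairs n) := by
  have h : 2 * #(ltPairs n) + n = n ^ 2 := by
    have h1 : #(ltPairs n) = #(Finset.univ.filter fun p : Fin n × Fin n => p.2 < p.1) :=
      Finset.card_bij (fun p _ => p.swap) (by simp) (by simp)
        fun b hb => ⟨b.swap, by simpa using hb, by simp⟩
    have h2 : n = #(Finset.univ.filter fun p : Fin n × Fin n => p.1 = p.2) := by
      have : (Finset.univ.filter fun p : Fin n × Fin n => p.1 = p.2) =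
          (Finset.univ : Finset (Fin n)).diag := by
        ext p; simp [Finset.mem_diag]
      rw [this, Finset.diag_card, Finset.card_univ, Fintype.card_fin]
    have h3 : n ^ 2 = #(Finset.univ : Finset (Fin n × Fin n)) := by simp [sq]
    conv_lhs => rw [two_mul]
    conv_lhs => rhs; rw [h2]
    conv_lhs => lhs; rhs; rw [h1]
    rw [h3, Finset.card_eq_sum_ones Finset.univ, Finset.card_filter, Finset.card_filter,
      Finset.card_filter, ← Finset.sum_add_distrib, ← Finset.sum_add_distrib]
    refine Finset.sum_congr rfl fun p _ => ?_
    rcases lt_trichotomy p.1 p.2 with h | h | h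
    · simp [h, h.ne, h.not_gt]
    · simp [h]
    · simp [h, h.ne', h.not_gt]
  have h3 : n ^ 2 ≤ 4 * #(ltPairs n) := by nlinarith
  exact_mod_cast h3

lemma sum_pairSum_apply_sq_le (k : Fin n) : ∑ p ∈ ltPairs n, pairSum p k ^ 2 ≤ 4 * n := by
  calc ∑ p ∈ ltPairs n, pairSum p k ^ 2
      ≤ ∑ p : Fin n × Fin n, pairSum p k ^ 2 :=
        Finset.sum_le_sum_of_subset_of_nonneg (Finset.filter_subset _ _)
          fun _ _ _ => sq_nonneg _
    _ ≤ ∑ p : Fin n × Fin n,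
        (2 * (if k = p.1 then 1 else 0) + 2 * if k = p.2 then 1 else 0) := by
        refine Finset.sum_le_sum fun p _ => ?_
        rw [pairSum_apply]
        split_ifs <;> norm_num
    _ = 4 * n := by
        have h1 : ∑ p : Fin n × Fin n, (if k = p.1 then (1 : ℝ) else 0) = n := by
          rw [Fintype.sum_prod_type_right]
          simp
        have h2 : ∑ p : Fin n × Fin n, (if k = p.2 then (1 : ℝ) else 0) = n := by
          rw [Fintype.sum_prod_type]
          simp
        rw [Finset.sum_add_distrib, ← Finset.mul_sum, ← Finset.mul_sum, h1, h2]
        ring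

lemma sum_pairSum_dotProduct_sq_le :
    ∑ p ∈ ltPairs n, ∑ q ∈ ltPairs n, (pairSum p ⬝ᵥ pairSum q) ^ 2 ≤
      16 * n * #(ltPairs n) := by
  have h : ∀ p ∈ ltPairs n, ∑ q ∈ ltPairs n, (pairSum p ⬝ᵥ pairSum q) ^ 2 ≤ 16 * n := by
    intro p _
    calc ∑ q ∈ ltPairs n, (pairSum p ⬝ᵥ pairSum q) ^ 2
        ≤ ∑ q ∈ ltPairs n, (2 * pairSum q p.1 ^ 2 + 2 * pairSum q p.2 ^ 2) := by
          refine Finset.sum_le_sum fun q _ => ?_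
          rw [pairSum_dotProduct]
          nlinarith [sq_nonneg (pairSum q p.1 - pairSum q p.2)]
      _ ≤ 16 * n := by
          rw [Finset.sum_add_distrib, ← Finset.mul_sum, ← Finset.mul_sum]
          linarith [sum_pairSum_apply_sq_le p.1, sum_pairSum_apply_sq_le p.2]
  refine (Finset.sum_le_sum h).trans_eq ?_
  rw [Finset.sum_const, nsmul_eq_mul]
  ring

end PairSums

section

theorem stmt5 :
    ∃ c > (0 : ℝ), ∀ n : ℕ, 2 ≤ n →
      ∀ 𝒱 : Finset (Fin n → ℝ),
        𝒱 = ((Finset.univ.filter fun p : Fin n × Fin n => p.1 < p.2).image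
              fun p => Pi.single p.1 (1 : ℝ) + Pi.single p.2 (1 : ℝ)) →
        (∫ a, dTV (MeasureTheory.Measure.map
              (torusFun (1 : Matrix (Fin n) (Fin n) ℝ) 𝒱 a) (torusMeasure n))
            (gaussianReal 0 1) ∂(coeffMeasure 𝒱))
          ≤ c / Real.sqrt n := by
  refine ⟨793, by norm_num, fun n hn 𝒱 h𝒱 => ?_⟩
  replace h𝒱 : 𝒱 = (ltPairs n).image pairSum := h𝒱
  have hmem : ∀ v : ↥𝒱, ∃ p : Fin n × Fin n, p.1 < p.2 ∧ pairSum p = v := by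
    rintro ⟨v, hv⟩
    rw [h𝒱, Finset.mem_image] at hv
    simpa using hv
  have hcard : Fintype.card ↥𝒱 = #(ltPairs n) := by
    rw [Fintype.card_coe, h𝒱, Finset.card_image_of_injOn injOn_pairSum]
  have hsum : ∑ v : ↥𝒱, ∑ w : ↥𝒱, ((v : Fin n → ℝ) ⬝ᵥ (w : Fin n → ℝ)) ^ 2 =
      ∑ p ∈ ltPairs n, ∑ q ∈ ltPairs n, (pairSum p ⬝ᵥ pairSum q) ^ 2 := by
    have hconv : ∀ g : (Fin n → ℝ) → ℝ, ∑ v : ↥𝒱, g v = ∑ p ∈ ltPairs n, g (pairSum p) := by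
      intro g
      rw [Finset.sum_coe_sort 𝒱 g, h𝒱, Finset.sum_image injOn_pairSum]
    rw [← hconv fun v => ∑ q ∈ ltPairs n, (v ⬝ᵥ pairSum q) ^ 2]
    exact Finset.sum_congr rfl fun v _ => hconv fun w => ((v : Fin n → ℝ) ⬝ᵥ w) ^ 2
  have hn0 : (0 : ℝ) < n := by exact_mod_cast (by omega : 0 < n)
  have hN := sq_le_four_mul_card_ltPairs hn
  have hN0 : (0 : ℝ) < #(ltPairs n) := by nlinarith
  have : Nonempty ↥𝒱 := by
    rw [← Fintype.card_pos_iff, hcard]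
    exact_mod_cast hN0
  rw [integral_coeffMeasure]
  simp_rw [torusFun_one]
  refine (integral_dTV_trigPoly_le (fun v : ↥𝒱 => (v : Fin n → ℝ)) ?_ ?_
    Subtype.val_injective ?_ (√n) (by positivity)).trans ?_
  · intro v k
    obtain ⟨p, -, hp⟩ := hmem v
    refine ⟨(if k = p.1 then 1 else 0) + if k = p.2 then 1 else 0, ?_⟩
    rw [← hp, pairSum_apply]
    push_cast
    rfl
  · intro v
    obtain ⟨p, hlt, hp⟩ := hmem v
    rw [← hp, pairSum_dotProduct_self hlt]
  · intro v w
    obtain ⟨p, -, hp⟩ := hmem v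
    obtain ⟨q, -, hq⟩ := hmem w
    rw [← hp, ← hq]
    exact pairSum_add_ne_zero p q
  · rw [hsum, hcard]
    set N : ℝ := (#(ltPairs n) : ℝ)
    have hT := sum_pairSum_dotProduct_sq_le (n := n)
    have h1 : 12 * (∑ p ∈ ltPairs n, ∑ q ∈ ltPairs n, (pairSum p ⬝ᵥ pairSum q) ^ 2) / N ^ 2 ≤
        768 / n := by
      rw [div_le_div_iff₀ (by positivity) hn0]
      calc _ ≤ 12 * (16 * n * N) * n := by gcongr
        _ = 192 * N * (n : ℝ) ^ 2 := by ring
        _ ≤ 192 * N * (4 * N) := by gcongr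
        _ = 768 * N ^ 2 := by ring
    have h2 : 6 / N ≤ 24 / n := by
      rw [div_le_div_iff₀ hN0 hn0]
      have : (2 : ℝ) ≤ n := by exact_mod_cast hn
      nlinarith
    calc √n * (6 / N + _) + 1 / √n ≤ √n * (24 / n + 768 / n) + 1 / √n := by gcongr
      _ = 793 / √n := by
        have hs : (√n : ℝ) ^ 2 = n := Real.sq_sqrt hn0.le
        have hs0 : 0 < √(n : ℝ) := by positivity
        field_simp
        rw [hs]
        ring

end
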